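/- arXiv:1502.06009 — 3 statements merged into one kernel-verified Lean document; each statement's English description precedes it below -/
import Mathlib

section
/- Let f, g, h : ℕ → ℤ be eventual quasi-polynomials, each eventually positive, with gcd(f(t), g(t)) = 1 for all t. Then there exist eventual quasi-polynomials r, s : ℕ → ℤ with deg(r) ≤ deg(g) and deg(s) ≤ max{deg(f), deg(h) − deg(g)}, such that for all sufficiently large t and all integers p, q with 0 ≤ p < g(t) and q < 0: p·f(t) + q·g(t) ∈ h(t) + ⟨f(t), g(t)⟩ if and only if p ≥ r(t) and q ≥ s(t). -/
/-- `f : ℕ → ℤ` is an eventual quasi-polynomial: for some period `m > 0` and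
component polynomials `c`, `f t = c (t % m) (t)` for all sufficiently large `t`. -/
def IsEQP (f : ℕ → ℤ) : Prop :=
  ∃ (N m : ℕ) (c : ℕ → Polynomial ℚ), 0 < m ∧
    ∀ t : ℕ, N ≤ t → (f t : ℚ) = (c (t % m)).eval (t : ℚ)

/-- `f` is an eventual quasi-polynomial of degree at most `k`. -/
def EQPDegLE (f : ℕ → ℤ) (k : ℕ) : Prop :=
  ∃ (N m : ℕ) (c : ℕ → Polynomial ℚ), 0 < m ∧ (∀ j, (c j).degree ≤ (k : ℕ)) ∧
    ∀ t : ℕ, N ≤ t → (f t : ℚ) = (c (t % m)).eval (t : ℚ)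

/-- The degree of an eventual quasi-polynomial: the least `k` such that `f` has an
eventual quasi-polynomial representation with all components of degree at most `k`. -/
noncomputable def EQPdeg (f : ℕ → ℤ) : ℕ := sInf {k | EQPDegLE f k}

/-- `f` is eventually positive. -/
def EventuallyPos (f : ℕ → ℤ) : Prop := ∃ N, ∀ t : ℕ, N ≤ t → 0 < f t

/-- `u` belongs to the numerical semigroup generated by `a 0, …, a (n-1)`. -/
def InSemigroup {n : ℕ} (a : Fin n → ℤ) (u : ℤ) : Prop :=
  ∃ p : Fin n → ℕ, u = ∑ i, (p i : ℤ) * a i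

/-- `u` belongs to the group generated by `a 0, …, a (n-1)`. -/
def InGroup {n : ℕ} (a : Fin n → ℤ) (u : ℤ) : Prop :=
  ∃ p : Fin n → ℤ, u = ∑ i, p i * a i

/-- `F` is the (generalized) Frobenius number of `a 0, …, a (n-1)`: the largest
element of the generated group that is not in the generated semigroup. -/
def IsFrobeniusNumber {n : ℕ} (a : Fin n → ℤ) (F : ℤ) : Prop :=
  IsGreatest {u : ℤ | InGroup a u ∧ ¬ InSemigroup a u} F

open Polynomial Filter

/-- `f : ℕ → ℤ` eventually agrees with a single rational polynomial. -/
def EventuallyPoly (f : ℕ → ℤ) : Prop :=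
  ∃ c : ℚ[X], ∀ᶠ t : ℕ in atTop, (f t : ℚ) = c.eval (t : ℚ)

namespace EventuallyPoly

variable {f g : ℕ → ℤ}

theorem const (a : ℤ) : EventuallyPoly fun _ => a :=
  ⟨C (a : ℚ), by simp⟩

theorem congr (hf : EventuallyPoly f) (h : ∀ᶠ t in atTop, f t = g t) : EventuallyPoly g := by
  obtain ⟨c, hc⟩ := hf
  exact ⟨c, by filter_upwards [hc, h] with t h1 h2; rw [← h2, h1]⟩

theorem add (hf : EventuallyPoly f) (hg : EventuallyPoly g) :
    EventuallyPoly fun t => f t + g t := by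
  obtain ⟨c, hc⟩ := hf
  obtain ⟨d, hd⟩ := hg
  exact ⟨c + d, by filter_upwards [hc, hd] with t h1 h2; simp [h1, h2]⟩

theorem mul (hf : EventuallyPoly f) (hg : EventuallyPoly g) :
    EventuallyPoly fun t => f t * g t := by
  obtain ⟨c, hc⟩ := hf
  obtain ⟨d, hd⟩ := hg
  exact ⟨c * d, by filter_upwards [hc, hd] with t h1 h2; simp [h1, h2]⟩

theorem sub (hf : EventuallyPoly f) (hg : EventuallyPoly g) :
    EventuallyPoly fun t => f t - g t := by
  obtain ⟨c, hc⟩ := hf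
  obtain ⟨d, hd⟩ := hg
  exact ⟨c - d, by filter_upwards [hc, hd] with t h1 h2; simp [h1, h2]⟩

theorem eval_int (P : ℤ[X]) : EventuallyPoly fun t => P.eval (t : ℤ) :=
  ⟨P.map (Int.castRingHom ℚ), Eventually.of_forall fun t => by
    simp⟩

theorem of_mul_eq {D : ℤ} (hD : D ≠ 0) (hf : EventuallyPoly f)
    (h : ∀ᶠ t in atTop, D * g t = f t) : EventuallyPoly g := by
  obtain ⟨c, hc⟩ := hf
  refine ⟨C ((D : ℚ)⁻¹) * c, ?_⟩
  filter_upwards [hc, h] with t h1 h2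
  have hD' : (D : ℚ) ≠ 0 := by exact_mod_cast hD
  rw [eval_mul, eval_C, ← h1, ← h2]
  push_cast
  field_simp

end EventuallyPoly

theorem tendsto_add_mul_atTop (j : ℕ) {m : ℕ} (hm : 0 < m) :
    Tendsto (fun n : ℕ => j + n * m) atTop atTop :=
  tendsto_atTop_mono (fun n => (Nat.le_mul_of_pos_right n hm).trans (Nat.le_add_left _ _)) tendsto_id

theorem EventuallyPoly.comp_affine {f : ℕ → ℤ} (hf : EventuallyPoly f) (j : ℕ) {m : ℕ}
    (hm : 0 < m) : EventuallyPoly fun n => f (j + n * m) := by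
  obtain ⟨c, hc⟩ := hf
  refine ⟨c.comp (C (j : ℚ) + X * C (m : ℚ)), ?_⟩
  filter_upwards [(tendsto_add_mul_atTop j hm).eventually hc] with n hn
  rw [hn]
  simp

/-- The values of a rational polynomial eventually keep a constant sign. -/
theorem Polynomial.eventually_nonneg_or_neg (c : ℚ[X]) :
    (∀ᶠ t : ℕ in atTop, 0 ≤ c.eval (t : ℚ)) ∨ ∀ᶠ t : ℕ in atTop, c.eval (t : ℚ) < 0 := by
  have hcast := tendsto_natCast_atTop_atTop (R := ℚ)
  rcases le_or_gt c.degree 0 with hd | hd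
  · rw [eq_C_of_degree_le_zero hd]
    rcases le_or_gt 0 (c.coeff 0) with h | h
    · left; simp [h]
    · right; simp [h]
  · rcases le_total 0 c.leadingCoeff with h | h
    · left
      exact ((c.tendsto_atTop_of_leadingCoeff_nonneg hd h).comp hcast).eventually_ge_atTop 0
    · right
      exact ((c.tendsto_atBot_of_leadingCoeff_nonpos hd h).comp hcast).eventually_lt_atBot 0

theorem EventuallyPoly.eventually_nonneg_or_neg {f : ℕ → ℤ} (hf : EventuallyPoly f) :
    (∀ᶠ t in atTop, 0 ≤ f t) ∨ ∀ᶠ t in atTop, f t < 0 := by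
  obtain ⟨c, hc⟩ := hf
  refine c.eventually_nonneg_or_neg.imp (fun h => ?_) (fun h => ?_)
  · filter_upwards [hc, h] with t h1 h2
    exact_mod_cast h1 ▸ h2
  · filter_upwards [hc, h] with t h1 h2
    exact_mod_cast h1 ▸ h2

theorem EventuallyPoly.min_zero {f : ℕ → ℤ} (hf : EventuallyPoly f) :
    EventuallyPoly fun t => min (f t) 0 := by
  rcases hf.eventually_nonneg_or_neg with h | h
  · exact (EventuallyPoly.const 0).congr (by filter_upwards [h] with t ht; simp [ht])
  · exact hf.congr (by filter_upwards [h] with t ht; simp [ht.le])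

/-- If `|P| ≤ |Q|` along a sequence tending to infinity, then `deg P ≤ deg Q`. -/
theorem Polynomial.degree_le_of_eventually_abs_le {P Q : ℚ[X]} {φ : ℕ → ℚ}
    (hφ : Tendsto φ atTop atTop)
    (h : ∀ᶠ n in atTop, |P.eval (φ n)| ≤ |Q.eval (φ n)|) : P.degree ≤ Q.degree := by
  by_contra! hlt
  have hP : P ≠ 0 := by rintro rfl; simp at hlt
  have hlim := (Q.div_tendsto_atTop_zero_of_degree_lt P hlt).comp hφ
  have hroot : ∀ᶠ n in atTop, P.eval (φ n) ≠ 0 :=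
    hφ.eventually (P.eventually_atTop_not_isRoot hP)
  have hsmall := (tendsto_order.1 hlim.abs).2 1 (by simp)
  obtain ⟨n, h1, h2, h3⟩ := (h.and (hroot.and hsmall)).exists
  simp only [Function.comp, abs_div] at h3
  rw [div_lt_one (abs_pos.2 h2)] at h3
  exact absurd h1 (not_le.2 h3)

/-- Clearing denominators of a rational polynomial. -/
theorem Polynomial.exists_int_eval_eq_mul (p : ℚ[X]) :
    ∃ D : ℕ, 0 < D ∧ ∃ P : ℤ[X], ∀ t : ℕ, ((P.eval (t : ℤ) : ℤ) : ℚ) = D * p.eval (t : ℚ) := by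
  induction p using Polynomial.induction_on' with
  | add p q hp hq =>
    obtain ⟨D, hD, P, hP⟩ := hp
    obtain ⟨E, hE, Q, hQ⟩ := hq
    refine ⟨D * E, by positivity, C (E : ℤ) * P + C (D : ℤ) * Q, fun t => ?_⟩
    simp only [eval_add, eval_mul, eval_C]
    push_cast
    rw [hP, hQ]
    ring
  | monomial n a =>
    refine ⟨a.den, a.den_pos, monomial n a.num, fun t => ?_⟩
    simp only [eval_monomial]
    push_cast
    rw [← mul_assoc, Rat.den_mul_eq_num]

/-- Values of an eventually polynomial function are eventually periodic modulo any `D`. -/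
theorem EventuallyPoly.exists_period_mod {f : ℕ → ℤ} (hf : EventuallyPoly f) (D : ℕ) (hD : 0 < D) :
    ∃ m : ℕ, 0 < m ∧ ∃ N : ℕ, ∀ t t' : ℕ, N ≤ t → N ≤ t' → (m : ℤ) ∣ (t : ℤ) - t' →
      (D : ℤ) ∣ f t - f t' := by
  obtain ⟨c, hc⟩ := hf
  obtain ⟨N, hN⟩ := eventually_atTop.1 hc
  obtain ⟨E, hE, P, hP⟩ := c.exists_int_eval_eq_mul
  refine ⟨E * D, by positivity, N, fun t t' ht ht' hdvd => ?_⟩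
  have key : ∀ t, N ≤ t → P.eval (t : ℤ) = E * f t := fun t ht => by
    have := hP t
    rw [← hN t ht] at this
    exact_mod_cast this
  have h1 := hdvd.trans (sub_dvd_eval_sub (t : ℤ) (t' : ℤ) P)
  rw [key t ht, key t' ht', ← mul_sub] at h1
  push_cast at h1
  exact Int.dvd_of_mul_dvd_mul_left (by positivity) h1

/-- Polynomials whose integer values are eventually coprime are coprime over `ℚ`. -/
theorem Polynomial.isCoprime_of_eventually_isCoprime {f g : ℕ → ℤ} {F G : ℚ[X]}
    (hf : ∀ᶠ t : ℕ in atTop, (f t : ℚ) = F.eval (t : ℚ))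
    (hg : ∀ᶠ t : ℕ in atTop, (g t : ℚ) = G.eval (t : ℚ))
    (hco : ∀ᶠ t in atTop, IsCoprime (f t) (g t)) : IsCoprime F G := by
  refine IsRelPrime.isCoprime fun d hdF hdG => ?_
  obtain ⟨F', rfl⟩ := hdF
  obtain ⟨G', rfl⟩ := hdG
  obtain ⟨A, hA, P, hP⟩ := d.exists_int_eval_eq_mul
  obtain ⟨B, hB, Q, hQ⟩ := F'.exists_int_eval_eq_mul
  obtain ⟨E, hE, R, hR⟩ := G'.exists_int_eval_eq_mul
  have hdvd : ∀ᶠ t : ℕ in atTop, P.eval (t : ℤ) ∣ A * B * E := by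
    filter_upwards [hf, hg, hco] with t h1 h2 h3
    have e1 : P.eval (t : ℤ) * Q.eval (t : ℤ) = A * B * f t := by
      have : ((P.eval (t : ℤ) * Q.eval (t : ℤ) : ℤ) : ℚ) = ((A * B * f t : ℤ) : ℚ) := by
        push_cast
        rw [hP, hQ, h1, eval_mul]
        ring
      exact_mod_cast this
    have e2 : P.eval (t : ℤ) * R.eval (t : ℤ) = A * E * g t := by
      have : ((P.eval (t : ℤ) * R.eval (t : ℤ) : ℤ) : ℚ) = ((A * E * g t : ℤ) : ℚ) := by
        push_cast
        rw [hP, hR, h2, eval_mul]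
        ring
      exact_mod_cast this
    obtain ⟨u, v, huv⟩ := h3
    refine ⟨E * u * Q.eval (t : ℤ) + B * v * R.eval (t : ℤ), ?_⟩
    linear_combination (-(A * B * E : ℤ)) * huv - E * u * e1 - B * v * e2
  have hne : d ≠ 0 := by
    rintro rfl
    obtain ⟨t, h1, h2, h3⟩ := (hf.and (hg.and hco)).exists
    simp only [zero_mul, eval_zero, Int.cast_eq_zero] at h1 h2
    rw [h1, h2] at h3
    exact not_isCoprime_zero_zero h3
  have hle : d.degree ≤ (C ((A * B * E : ℕ) : ℚ)).degree := by
    refine degree_le_of_eventually_abs_le (tendsto_natCast_atTop_atTop (R := ℚ)) ?_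
    filter_upwards [hdvd] with t ht
    have h1 : |P.eval (t : ℤ)| ≤ A * B * E :=
      Int.le_of_dvd (by positivity) ((abs_dvd _ _).2 ht)
    have h2 : |(A : ℚ) * d.eval (t : ℚ)| ≤ A * B * E := by
      rw [← hP]
      exact_mod_cast h1
    have hA1 : (1 : ℚ) ≤ A := by exact_mod_cast hA
    rw [abs_mul, Nat.abs_cast] at h2
    rw [eval_C, Nat.abs_cast]
    push_cast
    nlinarith [abs_nonneg (d.eval (t : ℚ))]
  exact isUnit_iff_degree_eq_zero.2
    (le_antisymm (hle.trans degree_C_le) (zero_le_degree_iff.2 hne))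

/-- Bézout coefficients of pointwise coprime eventually polynomial functions can be chosen
eventually polynomial on every residue class of a suitable modulus. -/
theorem EventuallyPoly.exists_bezout {f g : ℕ → ℤ} (hf : EventuallyPoly f)
    (hg : EventuallyPoly g) (hco : ∀ t, IsCoprime (f t) (g t)) :
    ∃ m : ℕ, 0 < m ∧ ∀ j : ℕ, ∃ u v : ℕ → ℤ, EventuallyPoly u ∧ EventuallyPoly v ∧
      ∀ᶠ n in atTop, u n * f (j + n * m) + v n * g (j + n * m) = 1 := by
  obtain ⟨F, hF⟩ := id hf
  obtain ⟨G, hG⟩ := id hg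
  obtain ⟨U, V, hUV⟩ :=
    isCoprime_of_eventually_isCoprime hF hG (Eventually.of_forall hco)
  obtain ⟨A, hA, P, hP⟩ := U.exists_int_eval_eq_mul
  obtain ⟨B, hB, Q, hQ⟩ := V.exists_int_eval_eq_mul
  have hPQ : ∀ᶠ t : ℕ in atTop,
      B * P.eval (t : ℤ) * f t + A * Q.eval (t : ℤ) * g t = (A * B : ℕ) := by
    filter_upwards [hF, hG] with t h1 h2
    have h3 := congrArg (eval (t : ℚ)) hUV
    simp only [eval_add, eval_mul, eval_one] at h3
    have : ((B * P.eval (t : ℤ) * f t + A * Q.eval (t : ℤ) * g t : ℤ) : ℚ) = (A * B : ℕ) := by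
      push_cast
      rw [hP, hQ, h1, h2]
      linear_combination (A * B : ℚ) * h3
    exact_mod_cast this
  have hD : 0 < A * B := by positivity
  obtain ⟨m₁, hm₁, N₁, hN₁⟩ := hf.exists_period_mod (A * B) hD
  obtain ⟨m₂, hm₂, N₂, hN₂⟩ := hg.exists_period_mod (A * B) hD
  have hm : 0 < m₁ * m₂ := by positivity
  refine ⟨m₁ * m₂, hm, fun j => ?_⟩
  have htend := tendsto_add_mul_atTop j hm
  obtain ⟨n₀, hn₀₁, hn₀₂⟩ :=
    ((htend.eventually_ge_atTop N₁).and (htend.eventually_ge_atTop N₂)).exists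
  obtain ⟨u₀, v₀, h₀⟩ := hco (j + n₀ * (m₁ * m₂))
  have hfj := hf.comp_affine j hm
  have hgj := hg.comp_affine j hm
  let a : ℕ → ℤ := fun n =>
    u₀ * f (j + n * (m₁ * m₂)) + v₀ * g (j + n * (m₁ * m₂)) - 1
  have ha : EventuallyPoly a :=
    (((EventuallyPoly.const u₀).mul hfj).add ((EventuallyPoly.const v₀).mul hgj)).sub
      (EventuallyPoly.const 1)
  let k : ℕ → ℤ := fun n => a n / (A * B : ℕ)
  have hk : ∀ᶠ n in atTop, ((A * B : ℕ) : ℤ) * k n = a n := by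
    filter_upwards [htend.eventually_ge_atTop N₁, htend.eventually_ge_atTop N₂] with n h1 h2
    refine Int.mul_ediv_cancel' ?_
    have d1 := hN₁ _ _ h1 hn₀₁ ⟨m₂ * (n - n₀), by push_cast; ring⟩
    have d2 := hN₂ _ _ h2 hn₀₂ ⟨m₁ * (n - n₀), by push_cast; ring⟩
    have ha' : a n = u₀ * (f (j + n * (m₁ * m₂)) - f (j + n₀ * (m₁ * m₂))) +
        v₀ * (g (j + n * (m₁ * m₂)) - g (j + n₀ * (m₁ * m₂))) := by
      simp only [a]
      linear_combination h₀
    rw [ha']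
    exact (d1.mul_left u₀).add (d2.mul_left v₀)
  have hkp : EventuallyPoly k := ha.of_mul_eq (by exact_mod_cast hD.ne') hk
  refine ⟨fun n => u₀ - k n * (B * P.eval ((j + n * (m₁ * m₂) : ℕ) : ℤ)),
    fun n => v₀ - k n * (A * Q.eval ((j + n * (m₁ * m₂) : ℕ) : ℤ)),
    (EventuallyPoly.const _).sub (hkp.mul ((EventuallyPoly.const _).mul
      ((EventuallyPoly.eval_int P).comp_affine j hm))),
    (EventuallyPoly.const _).sub (hkp.mul ((EventuallyPoly.const _).mul
      ((EventuallyPoly.eval_int Q).comp_affine j hm))), ?_⟩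
  filter_upwards [hk, htend.eventually hPQ] with n h1 h2
  linear_combination (-k n) * h2 - h1

/-- Integer quotients of eventually polynomial functions are eventually polynomial on every
residue class of a suitable modulus. -/
theorem EventuallyPoly.exists_ediv {p g : ℕ → ℤ} (hp : EventuallyPoly p)
    (hg : EventuallyPoly g) (hpos : ∀ᶠ t in atTop, 0 < g t) :
    ∃ m : ℕ, 0 < m ∧ ∀ j : ℕ, EventuallyPoly fun n => p (j + n * m) / g (j + n * m) := by
  obtain ⟨P, hP⟩ := id hp
  obtain ⟨G, hG⟩ := id hg
  have hG0 : G ≠ 0 := by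
    rintro rfl
    obtain ⟨t, h1, h2⟩ := (hG.and hpos).exists
    simp only [eval_zero, Int.cast_eq_zero] at h1
    omega
  obtain ⟨D, hD, A, hA⟩ := (P / G).exists_int_eval_eq_mul
  have hsmall : ∀ᶠ t : ℕ in atTop, |(D : ℚ) * (P % G).eval (t : ℚ)| < g t := by
    have hlim := ((P % G).div_tendsto_atTop_zero_of_degree_lt G (EuclideanDomain.mod_lt P hG0)).comp
      (tendsto_natCast_atTop_atTop (R := ℚ))
    have hD' : (0 : ℚ) < D := by exact_mod_cast hD
    have hlt := (tendsto_order.1 hlim.abs).2 (1 / D) (by simpa using hD')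
    filter_upwards [hlt, hG, hpos] with t h1 h2 h3
    have h3' : (0 : ℚ) < g t := by exact_mod_cast h3
    simp only [Function.comp, abs_div, ← h2, abs_of_pos h3'] at h1
    rw [div_lt_div_iff₀ h3' hD'] at h1
    rw [abs_mul, Nat.abs_cast]
    linarith
  refine ⟨D, hD, fun j => ?_⟩
  have htend := tendsto_add_mul_atTop j hD
  set c : ℤ := A.eval (j : ℤ) % D
  let e : ℕ → ℤ := fun n => A.eval ((j + n * D : ℕ) : ℤ) / D
  have hD0 : (D : ℤ) ≠ 0 := by exact_mod_cast hD.ne'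
  have he : ∀ n, (D : ℤ) * e n = A.eval ((j + n * D : ℕ) : ℤ) - c := fun n => by
    have hmod : A.eval ((j + n * D : ℕ) : ℤ) % D = c := by
      refine Int.emod_eq_emod_iff_emod_sub_eq_zero.2 (Int.emod_eq_zero_of_dvd ?_)
      refine dvd_trans ⟨n, ?_⟩ (sub_dvd_eval_sub ((j + n * D : ℕ) : ℤ) (j : ℤ) A)
      push_cast
      ring
    have := Int.mul_ediv_add_emod (A.eval ((j + n * D : ℕ) : ℤ)) D
    simp only [e]
    linarith
  have hep : EventuallyPoly e :=
    (((EventuallyPoly.eval_int A).comp_affine j hD).sub (EventuallyPoly.const c)).of_mul_eq hD0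
      (Eventually.of_forall he)
  let w : ℕ → ℤ := fun n => p (j + n * D) - e n * g (j + n * D)
  have hw : EventuallyPoly w := (hp.comp_affine j hD).sub (hep.mul (hg.comp_affine j hD))
  have hc0 : 0 ≤ c := Int.emod_nonneg _ hD0
  have hcD : c + 1 ≤ D := Int.emod_lt_of_pos _ (by exact_mod_cast hD)
  have hbound : ∀ᶠ n in atTop, -g (j + n * D) < D * w n ∧ w n < g (j + n * D) := by
    filter_upwards [htend.eventually hsmall, htend.eventually hP, htend.eventually hG,
      htend.eventually hpos] with n h1 h2 h3 h4
    have hAn := hA (j + n * D)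
    have hdm := congrArg (eval (((j + n * D : ℕ) : ℚ))) (EuclideanDomain.div_add_mod P G)
    rw [eval_add, eval_mul, ← h2, ← h3] at hdm
    have heq : ((D * w n - c * g (j + n * D) : ℤ) : ℚ) = D * (P % G).eval ((j + n * D : ℕ) : ℚ) := by
      have hen : (D : ℚ) * e n = D * (P / G).eval ((j + n * D : ℕ) : ℚ) - c := by
        rw [← hAn]
        exact_mod_cast he n
      simp only [w]
      push_cast at hen hdm ⊢
      linear_combination (-(g (j + n * D)) : ℚ) * hen - (D : ℚ) * hdm
    rw [← heq] at h1
    have h5 : |D * w n - c * g (j + n * D)| < g (j + n * D) := by exact_mod_cast h1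
    obtain ⟨h6, h7⟩ := abs_lt.1 h5
    have hDpos : (0 : ℤ) < D := by exact_mod_cast hD
    refine ⟨by nlinarith, ?_⟩
    have h8 : (D : ℤ) * w n < D * g (j + n * D) := by nlinarith
    exact lt_of_mul_lt_mul_left h8 hDpos.le
  rcases hw.eventually_nonneg_or_neg with hs | hs
  · refine hep.congr ?_
    filter_upwards [hs, hbound, htend.eventually hpos] with n h1 h2 h3
    symm
    rw [Int.ediv_eq_iff_of_pos h3]
    simp only [w] at h1 h2
    constructor <;> nlinarith
  · refine (hep.sub (EventuallyPoly.const 1)).congr ?_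
    filter_upwards [hs, hbound, htend.eventually hpos] with n h1 h2 h3
    have hDpos : (1 : ℤ) ≤ D := by exact_mod_cast hD
    have h4 : -g (j + n * D) < w n := by nlinarith
    symm
    rw [Int.ediv_eq_iff_of_pos h3]
    simp only [w] at h1 h4
    constructor <;> nlinarith

theorem IsEQP.exists_eventuallyPoly {f : ℕ → ℤ} (hf : IsEQP f) :
    ∃ m : ℕ, 0 < m ∧ ∀ k : ℕ, 0 < k → ∀ j : ℕ, EventuallyPoly fun n => f (j + n * (m * k)) := by
  obtain ⟨N, m, c, hm, hc⟩ := hf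
  refine ⟨m, hm, fun k hk j => ?_⟩
  refine ⟨(c (j % m)).comp (C (j : ℚ) + X * C ((m * k : ℕ) : ℚ)), ?_⟩
  filter_upwards [(tendsto_add_mul_atTop j (Nat.mul_pos hm hk)).eventually_ge_atTop N] with n hn
  have hmod : (j + n * (m * k)) % m = j % m := by
    rw [show n * (m * k) = m * (n * k) by ring, Nat.add_mul_mod_self_left]
  rw [hc _ hn, hmod]
  simp

theorem isEQP_of_eventuallyPoly {f : ℕ → ℤ} {m : ℕ} (hm : 0 < m)
    (h : ∀ j, EventuallyPoly fun n => f (j + n * m)) : IsEQP f := by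
  choose c hc using h
  have hall : ∀ᶠ n in atTop, ∀ j ∈ Finset.range m,
      (f (j + n * m) : ℚ) = (c j).eval (n : ℚ) :=
    (Finset.eventually_all _).2 fun j _ => hc j
  obtain ⟨N, hN⟩ := eventually_atTop.1 hall
  refine ⟨N * m, m, fun j => (c j).comp ((X - C (j : ℚ)) * C ((m : ℚ)⁻¹)), hm, fun t ht => ?_⟩
  have h1 := hN (t / m) ((Nat.le_div_iff_mul_le hm).2 ht) (t % m)
    (Finset.mem_range.2 (Nat.mod_lt _ hm))
  have h2 : t % m + t / m * m = t := by rw [mul_comm]; exact Nat.mod_add_div t m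
  have h3 : ((t : ℚ) - (t % m : ℕ)) * (m : ℚ)⁻¹ = (t / m : ℕ) := by
    have hm' : (m : ℚ) ≠ 0 := by exact_mod_cast hm.ne'
    have h4 : ((t % m : ℕ) : ℚ) + (t / m : ℕ) * m = t := by exact_mod_cast h2
    field_simp
    linarith
  rw [h2] at h1
  simp only [eval_comp, eval_mul, eval_sub, eval_X, eval_C]
  rw [h3, h1]

/-- A function that is an eventual quasi-polynomial on every residue class is one globally. -/
theorem isEQP_of_residues {f : ℕ → ℤ} {m : ℕ} (hm : 0 < m)
    (h : ∀ j, IsEQP fun n => f (j + n * m)) : IsEQP f := by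
  choose k hk hpoly using fun j => (h j).exists_eventuallyPoly
  have hprod : ∀ i, 0 < ∏ j ∈ Finset.range i, k j := fun i => Finset.prod_pos fun j _ => hk j
  refine isEQP_of_eventuallyPoly (m := m * ∏ j ∈ Finset.range m, k j)
    (Nat.mul_pos hm (hprod m)) fun i => ?_
  obtain ⟨l, hl⟩ : k (i % m) ∣ ∏ j ∈ Finset.range m, k j :=
    Finset.dvd_prod_of_mem k (Finset.mem_range.2 (Nat.mod_lt _ hm))
  have hl0 : 0 < l := Nat.pos_of_mul_pos_left (hl ▸ hprod m)
  have hi := hpoly (i % m) l hl0 (i / m)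
  rw [hl]
  convert hi using 3 with n
  linear_combination -(Nat.mod_add_div i m)

theorem IsEQP.exists_degLE {f : ℕ → ℤ} (hf : IsEQP f) : ∃ k, EQPDegLE f k := by
  obtain ⟨N, m, c, hm, hc⟩ := hf
  refine ⟨(Finset.range m).sup fun j => (c j).natDegree, N, m, fun j => c (j % m), hm,
    fun j => ?_, fun t ht => by simpa only [Nat.mod_mod] using hc t ht⟩
  refine degree_le_natDegree.trans ?_
  exact_mod_cast Finset.le_sup (f := fun j => (c j).natDegree)
    (Finset.mem_range.2 (Nat.mod_lt j hm))

theorem EQPdeg_le_of_eventually_abs_le {f g : ℕ → ℤ} (hf : IsEQP f) (hg : IsEQP g)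
    (h : ∀ᶠ t in atTop, |f t| ≤ |g t|) : EQPdeg f ≤ EQPdeg g := by
  have hmem : EQPDegLE g (EQPdeg g) := Nat.sInf_mem hg.exists_degLE
  obtain ⟨N₁, m₁, c₁, hm₁, hc₁⟩ := hf
  obtain ⟨N₂, m₂, c₂, hm₂, hdeg, hc₂⟩ := hmem
  refine Nat.sInf_le ⟨N₁, m₁ * m₂, fun j => c₁ (j % m₁), by positivity, fun j => ?_,
    fun t ht => by simpa only [Nat.mod_mul_right_mod] using hc₁ t ht⟩
  refine le_trans ?_ (hdeg (j % m₂))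
  have htend := tendsto_add_mul_atTop j (Nat.mul_pos hm₁ hm₂)
  refine degree_le_of_eventually_abs_le ((tendsto_natCast_atTop_atTop (R := ℚ)).comp htend) ?_
  filter_upwards [htend.eventually h, htend.eventually_ge_atTop N₁,
    htend.eventually_ge_atTop N₂] with n h1 h2 h3
  have e1 : (j + n * (m₁ * m₂)) % m₁ = j % m₁ := by
    rw [show n * (m₁ * m₂) = m₁ * (n * m₂) by ring, Nat.add_mul_mod_self_left]
  have e2 : (j + n * (m₁ * m₂)) % m₂ = j % m₂ := by
    rw [show n * (m₁ * m₂) = m₂ * (n * m₁) by ring, Nat.add_mul_mod_self_left]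
  have h4 := hc₁ _ h2
  have h5 := hc₂ _ h3
  rw [e1] at h4
  rw [e2] at h5
  simp only [Function.comp]
  rw [← h4, ← h5]
  exact_mod_cast h1

/-- The coefficient `a` in the representation `h = a * f + b * g` with `0 ≤ a < g`,
for coprime `f` and `g`. -/
def leftCoeff (f g h : ℤ) : ℤ := h * Int.gcdA f g % g

/-- The coefficient `b` in the representation `h = a * f + b * g` with `0 ≤ a < g`,
for coprime `f` and `g`. -/
def rightCoeff (f g h : ℤ) : ℤ := (h - leftCoeff f g h * f) / g

theorem leftCoeff_mul_add_rightCoeff_mul {f g : ℤ} (hco : Int.gcd f g = 1) (h : ℤ) :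
    leftCoeff f g h * f + rightCoeff f g h * g = h := by
  have hdvd : g ∣ h - leftCoeff f g h * f := by
    have hb := Int.gcd_eq_gcd_ab f g
    rw [hco] at hb
    have hdm := Int.mul_ediv_add_emod (h * Int.gcdA f g) g
    refine ⟨h * Int.gcdB f g + f * (h * Int.gcdA f g / g), ?_⟩
    unfold leftCoeff
    push_cast at hb
    linear_combination h * hb - f * hdm
  have := Int.ediv_mul_cancel hdvd
  unfold rightCoeff
  linarith

theorem coeff_eq_of_bezout {f g u v : ℤ} (hg : 0 < g) (hco : Int.gcd f g = 1)
    (huv : u * f + v * g = 1) (h : ℤ) :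
    leftCoeff f g h = h * u - g * (h * u / g) ∧
      rightCoeff f g h = h * v + f * (h * u / g) := by
  have hsum := leftCoeff_mul_add_rightCoeff_mul hco h
  have hleft : leftCoeff f g h = h * u - g * (h * u / g) := by
    have hb := Int.gcd_eq_gcd_ab f g
    rw [hco] at hb
    push_cast at hb
    have hdm := Int.mul_ediv_add_emod (h * u) g
    have hmod : h * Int.gcdA f g % g = h * u % g := by
      refine Int.ModEq.symm (Int.modEq_iff_dvd.2 ⟨h * (v * Int.gcdA f g - u * Int.gcdB f g), ?_⟩)
      linear_combination -h * Int.gcdA f g * huv - h * u * hb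
    rw [leftCoeff, hmod]
    linarith
  refine ⟨hleft, mul_right_cancel₀ hg.ne' ?_⟩
  rw [hleft] at hsum
  linear_combination hsum - h * huv

theorem neg_lt_rightCoeff {f g h : ℤ} (hf : 0 < f) (hg : 0 < g) (hh : 0 < h)
    (hco : Int.gcd f g = 1) : -f < rightCoeff f g h := by
  have hsum := leftCoeff_mul_add_rightCoeff_mul hco h
  have hag : leftCoeff f g h < g := Int.emod_lt_of_pos _ hg
  by_contra! hle
  nlinarith

theorem mem_translate_iff {f g h p q : ℤ} (hf : 0 < f) (hg : 0 < g) (hh : 0 < h)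
    (hco : Int.gcd f g = 1) (hpg : p < g) (hq : q < 0) :
    (∃ x y : ℕ, p * f + q * g = h + (x : ℤ) * f + (y : ℤ) * g) ↔
      leftCoeff f g h ≤ p ∧ min (rightCoeff f g h) 0 ≤ q := by
  have hsum := leftCoeff_mul_add_rightCoeff_mul hco h
  have ha0 : 0 ≤ leftCoeff f g h := Int.emod_nonneg _ hg.ne'
  have hbf := neg_lt_rightCoeff hf hg hh hco
  generalize leftCoeff f g h = a at *
  generalize rightCoeff f g h = b at *
  rw [min_le_iff, or_iff_left (not_le.2 hq)]
  constructor
  · rintro ⟨x, y, hxy⟩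
    have heq : (p - a - x) * f = (b + y - q) * g := by linear_combination hxy - hsum
    obtain ⟨z, hz⟩ : g ∣ p - a - x :=
      (Int.isCoprime_iff_gcd_eq_one.2 hco).symm.dvd_of_dvd_mul_right ⟨b + y - q, by
        rw [heq]; ring⟩
    have hbz : b + y - q = z * f := by
      refine mul_right_cancel₀ hg.ne' ?_
      rw [← heq, hz]
      ring
    have hx : (0 : ℤ) ≤ x := x.cast_nonneg
    have hy : (0 : ℤ) ≤ y := y.cast_nonneg
    have hz0 : z ≤ 0 := by
      by_contra! hz1
      nlinarith
    have hz1 : 0 ≤ z := by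
      by_contra! hz1
      nlinarith
    obtain rfl : z = 0 := le_antisymm hz0 hz1
    constructor <;> linarith
  · rintro ⟨h1, h2⟩
    refine ⟨(p - a).toNat, (q - b).toNat, ?_⟩
    rw [Int.toNat_of_nonneg (by linarith), Int.toNat_of_nonneg (by linarith)]
    linear_combination hsum

theorem isEQP_coeff_of_eventuallyPoly {f g h : ℕ → ℤ} (hf : EventuallyPoly f)
    (hg : EventuallyPoly g) (hh : EventuallyPoly h) (hpos : ∀ᶠ t in atTop, 0 < g t)
    (hco : ∀ t, Int.gcd (f t) (g t) = 1) :
    (IsEQP fun t => leftCoeff (f t) (g t) (h t)) ∧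
      IsEQP fun t => min (rightCoeff (f t) (g t) (h t)) 0 := by
  obtain ⟨m, hm, hbez⟩ := hf.exists_bezout hg fun t => Int.isCoprime_iff_gcd_eq_one.2 (hco t)
  have key : ∀ j, (IsEQP fun n => leftCoeff (f (j + n * m)) (g (j + n * m)) (h (j + n * m))) ∧
      IsEQP fun n => min (rightCoeff (f (j + n * m)) (g (j + n * m)) (h (j + n * m))) 0 := by
    intro j
    obtain ⟨u, v, hu, hv, huv⟩ := hbez j
    have hfj := hf.comp_affine j hm
    have hgj := hg.comp_affine j hm
    have hhj := hh.comp_affine j hm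
    have hposj := (tendsto_add_mul_atTop j hm).eventually hpos
    obtain ⟨k, hk, hdiv⟩ := (hhj.mul hu).exists_ediv hgj hposj
    refine ⟨isEQP_of_eventuallyPoly hk fun i => ?_, isEQP_of_eventuallyPoly hk fun i => ?_⟩
    · refine (((hhj.mul hu).comp_affine i hk).sub
        ((hgj.comp_affine i hk).mul (hdiv i))).congr ?_
      filter_upwards [(tendsto_add_mul_atTop i hk).eventually huv,
        (tendsto_add_mul_atTop i hk).eventually hposj] with n h1 h2
      exact ((coeff_eq_of_bezout h2 (hco _) h1 _).1).symm
    · refine (((hhj.mul hv).comp_affine i hk).add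
        ((hfj.comp_affine i hk).mul (hdiv i))).min_zero.congr ?_
      filter_upwards [(tendsto_add_mul_atTop i hk).eventually huv,
        (tendsto_add_mul_atTop i hk).eventually hposj] with n h1 h2
      rw [(coeff_eq_of_bezout h2 (hco _) h1 _).2]
  exact ⟨isEQP_of_residues hm fun j => (key j).1, isEQP_of_residues hm fun j => (key j).2⟩

theorem isEQP_coeff {f g h : ℕ → ℤ} (hf : IsEQP f) (hg : IsEQP g) (hh : IsEQP h)
    (hpos : ∀ᶠ t in atTop, 0 < g t) (hco : ∀ t, Int.gcd (f t) (g t) = 1) :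
    (IsEQP fun t => leftCoeff (f t) (g t) (h t)) ∧
      IsEQP fun t => min (rightCoeff (f t) (g t) (h t)) 0 := by
  obtain ⟨a, ha, hfa⟩ := hf.exists_eventuallyPoly
  obtain ⟨b, hb, hgb⟩ := hg.exists_eventuallyPoly
  obtain ⟨c, hc, hhc⟩ := hh.exists_eventuallyPoly
  have hm : 0 < a * b * c := by positivity
  have key := fun j => isEQP_coeff_of_eventuallyPoly
    (f := fun n => f (j + n * (a * b * c))) (g := fun n => g (j + n * (a * b * c)))
    (h := fun n => h (j + n * (a * b * c)))
    (by simpa only [mul_assoc] using hfa (b * c) (by positivity) j)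
    (by simpa only [show b * (a * c) = a * b * c by ring] using hgb (a * c) (by positivity) j)
    (by simpa only [show c * (a * b) = a * b * c by ring] using hhc (a * b) (by positivity) j)
    ((tendsto_add_mul_atTop j hm).eventually hpos) (fun n => hco _)
  exact ⟨isEQP_of_residues hm fun j => (key j).1, isEQP_of_residues hm fun j => (key j).2⟩

theorem EventuallyPos.eventually {f : ℕ → ℤ} (hf : EventuallyPos f) :
    ∀ᶠ t in atTop, 0 < f t :=
  eventually_atTop.2 hf

/-- **Lemma (one translate).** For eventually positive eventual quasi-polynomials
`f, g, h` with `gcd(f(t), g(t)) = 1` for all `t`, there are eventual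
quasi-polynomials `r, s` with `deg r ≤ deg g` and
`deg s ≤ max(deg f, deg h - deg g)` such that eventually, for all `p, q ∈ ℤ` with
`0 ≤ p < g(t)` and `q < 0`:
`p f(t) + q g(t) ∈ h(t) + ⟨f(t), g(t)⟩ ↔ (p, q) ≥ (r(t), s(t))`. -/
theorem eqp_one_translate (f g h : ℕ → ℤ) (hf : IsEQP f) (hg : IsEQP g)
    (hh : IsEQP h) (hfp : EventuallyPos f) (hgp : EventuallyPos g)
    (hhp : EventuallyPos h) (hco : ∀ t : ℕ, Int.gcd (f t) (g t) = 1) :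
    ∃ r s : ℕ → ℤ, IsEQP r ∧ IsEQP s ∧
      EQPdeg r ≤ EQPdeg g ∧ EQPdeg s ≤ max (EQPdeg f) (EQPdeg h - EQPdeg g) ∧
      ∃ N, ∀ t : ℕ, N ≤ t → ∀ p q : ℤ, 0 ≤ p → p < g t → q < 0 →
        ((∃ x y : ℕ, p * f t + q * g t = h t + (x : ℤ) * f t + (y : ℤ) * g t) ↔
          (r t ≤ p ∧ s t ≤ q)) := by
  have hfp' := hfp.eventually
  have hgp' := hgp.eventually
  have hhp' := hhp.eventually
  obtain ⟨hr, hs⟩ := isEQP_coeff hf hg hh hgp' hco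
  refine ⟨_, _, hr, hs, EQPdeg_le_of_eventually_abs_le hr hg ?_,
    le_max_of_le_left (EQPdeg_le_of_eventually_abs_le hs hf ?_), ?_⟩
  · filter_upwards [hgp'] with t ht
    have h0 : 0 ≤ leftCoeff (f t) (g t) (h t) := Int.emod_nonneg _ ht.ne'
    have h1 : leftCoeff (f t) (g t) (h t) < g t := Int.emod_lt_of_pos _ ht
    rw [abs_of_nonneg h0, abs_of_pos ht]
    exact h1.le
  · filter_upwards [hfp', hgp', hhp'] with t h1 h2 h3
    have h4 := neg_lt_rightCoeff h1 h2 h3 (hco t)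
    rw [abs_of_pos h1, abs_of_nonpos (min_le_right _ _), neg_le]
    exact le_min h4.le (by linarith)
  · refine eventually_atTop.1 ?_
    filter_upwards [hfp', hgp', hhp'] with t h1 h2 h3 p q _ hpg hq
    exact mem_translate_iff h1 h2 h3 (hco t) hpg hq
end

section
/- Let a_1, a_2, a_3 be positive integers with gcd(a_1, a_2, a_3) = 1, let e = gcd(a_1, a_2), and suppose the triple (a_1/e, a_2/e, a_3) admits a Frobenius number (its entries are not all equal). Then F(a_1, a_2, a_3) = e · F(a_1/e, a_2/e, a_3) + a_3(e − 1). -/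
/-- If `e > 0` is coprime to `c` and `F` is the largest integer not of the form
`x b₁ + y b₂ + z c` with `x, y, z ∈ ℕ`, then `e F + c (e - 1)` is the largest integer not of the
form `x (e b₁) + y (e b₂) + z c`. -/
theorem isGreatest_not_representable_mul {e b₁ b₂ c F : ℤ} (he : 0 < e) (hc : 0 < c)
    (hec : IsCoprime e c)
    (hF : IsGreatest {u : ℤ | ¬ ∃ x y z : ℕ,
      u = (x : ℤ) * b₁ + (y : ℤ) * b₂ + (z : ℤ) * c} F) :
    IsGreatest {u : ℤ | ¬ ∃ x y z : ℕ,
      u = (x : ℤ) * (e * b₁) + (y : ℤ) * (e * b₂) + (z : ℤ) * c} (e * F + c * (e - 1)) := by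
  constructor
  · rintro ⟨x, y, z, h⟩
    obtain ⟨k, hk⟩ : e ∣ (z : ℤ) + 1 :=
      hec.dvd_of_dvd_mul_left ⟨F + c - x * b₁ - y * b₂, by linear_combination -h⟩
    have hk1 : 0 < k := pos_of_mul_pos_right (by omega : 0 < e * k) he.le
    refine hF.1 ⟨x, y, (k - 1).toNat, ?_⟩
    rw [Int.toNat_of_nonneg (by omega)]
    exact mul_left_cancel₀ he.ne' (by linear_combination h + c * hk)
  · intro u hu
    by_contra! hlt
    obtain ⟨r, s, hrs⟩ := hec
    have hz0 : 0 ≤ u * s % e := Int.emod_nonneg _ he.ne'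
    have hze : u * s % e < e := Int.emod_lt_of_pos _ he
    have hdiv := Int.emod_add_mul_ediv (u * s) e
    generalize u * s % e = z at hz0 hze hdiv
    generalize u * s / e = q at hdiv
    have huv : u = e * (u * r + q * c) + z * c := by
      linear_combination -u * hrs - c * hdiv
    generalize u * r + q * c = v at huv
    have hv : F < v := by
      refine lt_of_mul_lt_mul_left (a := e) ?_ he.le
      nlinarith [mul_nonneg hc.le (by omega : 0 ≤ e - 1 - z)]
    obtain ⟨x, y, w, hw⟩ : ∃ x y w : ℕ, v = (x : ℤ) * b₁ + (y : ℤ) * b₂ + (w : ℤ) * c := by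
      by_contra h
      exact absurd (hF.2 h) (not_le.2 hv)
    refine hu ⟨x, y, (e * w + z).toNat, ?_⟩
    rw [Int.toNat_of_nonneg (by positivity)]
    linear_combination huv + e * hw

/-- **Rødseth reduction (Step 2).** For positive `a₁, a₂, a₃` with
`gcd(a₁, a₂, a₃) = 1` and `e = gcd(a₁, a₂)`, if the triple `(a₁/e, a₂/e, a₃)`
admits a Frobenius number, then
`F(a₁, a₂, a₃) = e · F(a₁/e, a₂/e, a₃) + a₃ (e - 1)`. -/
theorem rodseth_reduction (a₁ a₂ a₃ : ℤ) (h1 : 0 < a₁) (h2 : 0 < a₂) (h3 : 0 < a₃)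
    (hgcd : Int.gcd (Int.gcd a₁ a₂) a₃ = 1)
    (hne : ¬ (a₁ / (Int.gcd a₁ a₂ : ℤ) = a₂ / (Int.gcd a₁ a₂ : ℤ) ∧
              a₁ / (Int.gcd a₁ a₂ : ℤ) = a₃))
    (F₁ F₂ : ℤ)
    (hF₁ : IsGreatest {u : ℤ | ¬ ∃ x y z : ℕ,
        u = (x : ℤ) * a₁ + (y : ℤ) * a₂ + (z : ℤ) * a₃} F₁)
    (hF₂ : IsGreatest {u : ℤ | ¬ ∃ x y z : ℕ,
        u = (x : ℤ) * (a₁ / (Int.gcd a₁ a₂ : ℤ)) +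
            (y : ℤ) * (a₂ / (Int.gcd a₁ a₂ : ℤ)) + (z : ℤ) * a₃} F₂) :
    F₁ = (Int.gcd a₁ a₂ : ℤ) * F₂ + a₃ * ((Int.gcd a₁ a₂ : ℤ) - 1) := by
  have he : (0 : ℤ) < Int.gcd a₁ a₂ := by exact_mod_cast Int.gcd_pos_of_ne_zero_left _ h1.ne'
  have h := isGreatest_not_representable_mul he h3 (Int.isCoprime_iff_gcd_eq_one.2 hgcd) hF₂
  rw [Int.mul_ediv_cancel' (Int.gcd_dvd_left a₁ a₂),
    Int.mul_ediv_cancel' (Int.gcd_dvd_right a₁ a₂)] at h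
  exact hF₁.unique h
end

section
/- Let f, g, a : ℕ → ℤ be eventual quasi-polynomials with f and g eventually positive and gcd(f(t), g(t)) = 1 for all sufficiently large t. Then there exists an eventual quasi-polynomial s_0 : ℕ → ℤ such that for all sufficiently large t, g(t)·s_0(t) ≡ a(t) (mod f(t)) and 0 ≤ s_0(t) < f(t). -/
open Polynomial Filter

/-- Every rational polynomial has a positive integer multiple with integer coefficients. -/
theorem exists_intPolynomial_map_eq_mul (p : ℚ[X]) :
    ∃ d : ℕ, 0 < d ∧ ∃ P : ℤ[X], P.map (Int.castRingHom ℚ) = C (d : ℚ) * p := by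
  obtain ⟨b, hbmem, hb⟩ := IsLocalization.integerNormalization_spec (nonZeroDivisors ℤ) p
  have hb0 : b ≠ 0 := nonZeroDivisors.ne_zero hbmem
  refine ⟨b.natAbs, Int.natAbs_pos.mpr hb0, ?_⟩
  have hb' : (IsLocalization.integerNormalization (nonZeroDivisors ℤ) p).map (Int.castRingHom ℚ)
      = C (b : ℚ) * p := by
    rw [← smul_eq_C_mul, Int.cast_smul_eq_zsmul]
    exact hb
  rcases Int.natAbs_eq b with h | h
  · have h' : (b : ℚ) = (b.natAbs : ℚ) := by
      rw [← Int.cast_natCast, ← h]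
    exact ⟨_, h' ▸ hb'⟩
  · refine ⟨-IsLocalization.integerNormalization (nonZeroDivisors ℤ) p, ?_⟩
    have h' : (b : ℚ) = -(b.natAbs : ℚ) := by
      rw [← Int.cast_natCast, ← Int.cast_neg, ← h]
    rw [Polynomial.map_neg, hb', h', C_neg]
    ring

theorem Polynomial.cast_eval_natCast_eq (P : ℤ[X]) (n : ℕ) :
    ((P.eval (n : ℤ) : ℤ) : ℚ) = (P.map (Int.castRingHom ℚ)).eval (n : ℚ) := by
  simp

/-- Integer values of an integer polynomial are congruent at congruent arguments. -/
theorem Polynomial.dvd_eval_sub_eval_of_mod_eq (P : ℤ[X]) {m n k : ℕ} (h : n % m = k % m) :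
    (m : ℤ) ∣ P.eval (n : ℤ) - P.eval (k : ℤ) :=
  (Nat.modEq_iff_dvd.mp (Nat.ModEq.symm h)).trans (sub_dvd_eval_sub _ _ _)

/-- A rational polynomial has eventually constant sign. -/
theorem Polynomial.eventually_nonneg_or_eventually_neg (p : ℚ[X]) :
    (∀ᶠ x in atTop, 0 ≤ p.eval x) ∨ ∀ᶠ x in atTop, p.eval x < 0 := by
  rcases lt_or_ge 0 p.degree with hd | hd
  · rcases le_total 0 p.leadingCoeff with h | h
    · exact .inl ((p.tendsto_atTop_of_leadingCoeff_nonneg hd h).eventually_ge_atTop 0)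
    · exact .inr ((p.tendsto_atBot_of_leadingCoeff_nonpos hd h).eventually_lt_atBot 0)
  · rw [eq_C_of_degree_le_zero hd]
    rcases le_or_gt 0 (p.coeff 0) with h | h <;> simp [h]

theorem isEQP_of_forall_residue {s : ℕ → ℤ} {m : ℕ} (hm : 0 < m)
    (h : ∀ j < m, ∃ p : ℚ[X], ∀ᶠ n : ℕ in atTop, n % m = j → (s n : ℚ) = p.eval (n : ℚ)) :
    IsEQP s := by
  choose! c hc using h
  have hall : ∀ᶠ n : ℕ in atTop, ∀ j ∈ Finset.range m, n % m = j →
      (s n : ℚ) = (c j).eval (n : ℚ) :=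
    (Filter.eventually_all_finset _).mpr fun j hj => hc j (Finset.mem_range.mp hj)
  obtain ⟨N, hN⟩ := eventually_atTop.mp hall
  exact ⟨N, m, c, hm, fun t ht => hN t ht _ (Finset.mem_range.mpr (Nat.mod_lt _ hm)) rfl⟩

theorem tendsto_mul_add_atTop {m : ℕ} (hm : 0 < m) (r : ℕ) :
    Tendsto (fun n : ℕ => m * n + r) atTop atTop :=
  tendsto_atTop_mono (fun n => (Nat.le_mul_of_pos_left n hm).trans (Nat.le_add_right _ _)) tendsto_id

/-- A function whose restrictions to the residue classes mod `m` are eventual quasi-polynomials is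
an eventual quasi-polynomial. -/
theorem isEQP_of_forall_isEQP_comp {s : ℕ → ℤ} {m : ℕ} (hm : 0 < m)
    (h : ∀ r < m, IsEQP fun n => s (m * n + r)) : IsEQP s := by
  choose! N k c hk hc using h
  have hK : 0 < ∏ r ∈ Finset.range m, k r :=
    Finset.prod_pos fun r hr => hk r (Finset.mem_range.mp hr)
  refine isEQP_of_forall_residue (Nat.mul_pos hm hK) fun j _ => ?_
  have hr : j % m < m := Nat.mod_lt _ hm
  refine ⟨(c (j % m) (j / m % k (j % m))).comp (C (m : ℚ)⁻¹ * (X - C ((j % m : ℕ) : ℚ))), ?_⟩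
  filter_upwards [eventually_ge_atTop (m * N (j % m) + m)] with t ht htj
  have h1 : t % m = j % m := by rw [← htj, Nat.mod_mul_right_mod]
  have h2 : t / m % k (j % m) = j / m % k (j % m) := by
    have hdvd := Finset.dvd_prod_of_mem k (Finset.mem_range.mpr hr)
    have hdiv : j / m = t / m % ∏ r ∈ Finset.range m, k r := by
      rw [← htj, Nat.mod_mul_right_div_self]
    rw [hdiv, Nat.mod_mod_of_dvd _ hdvd]
  have h3 : m * (t / m) + j % m = t := by rw [← h1, Nat.div_add_mod]
  have h4 : N (j % m) ≤ t / m := by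
    rw [Nat.le_div_iff_mul_le hm]
    nlinarith
  have h5 := hc (j % m) hr (t / m) h4
  simp only [h3, h2] at h5
  have h6 : ((m : ℚ)⁻¹ * ((t : ℚ) - ((j % m : ℕ) : ℚ))) = ((t / m : ℕ) : ℚ) := by
    have hm' : (m : ℚ) ≠ 0 := by positivity
    have h3' : (m : ℚ) * ((t / m : ℕ) : ℚ) + ((j % m : ℕ) : ℚ) = t := by exact_mod_cast h3
    rw [← h3']
    field_simp
    ring
  rw [h5, eval_comp]
  simp only [eval_mul, eval_C, eval_sub, eval_X]
  rw [h6]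

theorem IsEQP.mul {f g : ℕ → ℤ} (hf : IsEQP f) (hg : IsEQP g) : IsEQP fun t => f t * g t := by
  obtain ⟨N, m, c, hm, hc⟩ := hf
  obtain ⟨N', m', c', hm', hc'⟩ := hg
  refine ⟨max N N', m * m', fun j => c (j % m) * c' (j % m'), Nat.mul_pos hm hm', fun t ht => ?_⟩
  simp only [Nat.mod_mul_right_mod, Nat.mod_mul_left_mod]
  rw [eval_mul, ← hc t (le_of_max_le_left ht),
    ← hc' t (le_of_max_le_right ht), Int.cast_mul]

/-- `f` coincides eventually with an integer polynomial along each progression `m * n + r`. -/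
def EventuallyIntPolynomialMod (f : ℕ → ℤ) (m : ℕ) : Prop :=
  ∀ r : ℕ, ∃ P : ℤ[X], ∀ᶠ n : ℕ in atTop, f (m * n + r) = P.eval (n : ℤ)

theorem EventuallyIntPolynomialMod.mul_right {f : ℕ → ℤ} {m k : ℕ}
    (h : EventuallyIntPolynomialMod f m) (hk : 0 < k) :
    EventuallyIntPolynomialMod f (m * k) := by
  intro r
  obtain ⟨P, hP⟩ := h r
  refine ⟨P.comp (C (k : ℤ) * X), ?_⟩
  filter_upwards [(tendsto_mul_add_atTop hk 0).eventually hP] with n hn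
  simpa [mul_assoc] using hn

theorem Polynomial.C_dvd_comp_sub_C (P : ℤ[X]) (a r : ℤ) :
    C a ∣ P.comp (C a * X + C r) - C (P.eval r) := by
  have h := sub_dvd_eval_sub (C a * X + C r) (C r) (P.map C)
  rw [eval_map, eval_map, ← comp, ← comp, comp_C] at h
  exact (Dvd.intro X (by ring)).trans h

theorem IsEQP.exists_eventuallyIntPolynomialMod {f : ℕ → ℤ} (hf : IsEQP f) :
    ∃ m, 0 < m ∧ EventuallyIntPolynomialMod f m := by
  obtain ⟨N, m, c, hm, hc⟩ := hf
  choose d hd P hP using fun j => exists_intPolynomial_map_eq_mul (c j)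
  set D := ∏ j ∈ Finset.range m, d j
  have hD0 : 0 < D := Finset.prod_pos fun j _ => hd j
  have hmD : 0 < m * D := Nat.mul_pos hm hD0
  refine ⟨m * D, hmD, fun r => ?_⟩
  set j := r % m
  have hdj : (d j : ℤ) ∣ (m * D : ℕ) :=
    Int.natCast_dvd_natCast.mpr ((Finset.dvd_prod_of_mem d
      (Finset.mem_range.mpr (Nat.mod_lt r hm))).trans (Dvd.intro_left m rfl))
  obtain ⟨S, hS⟩ := (map_dvd C hdj).trans ((P j).C_dvd_comp_sub_C (m * D : ℕ) r)
  have hd0 : (d j : ℤ) ≠ 0 := by exact_mod_cast (hd j).ne'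
  have hval : ∀ n : ℕ, N ≤ m * D * n + r →
      (d j : ℤ) * f (m * D * n + r) = (P j).eval (r : ℤ) + d j * S.eval (n : ℤ) := by
    intro n hn
    have h1 := hc _ hn
    have h2 : (m * D * n + r) % m = j := by rw [mul_assoc, Nat.mul_add_mod]
    rw [h2] at h1
    have h3 := (P j).cast_eval_natCast_eq (m * D * n + r)
    rw [hP, eval_mul, eval_C, ← h1] at h3
    have h4 : (d j : ℤ) * f (m * D * n + r) = (P j).eval ((m * D * n + r : ℕ) : ℤ) := by
      exact_mod_cast h3.symm
    have h5 := congrArg (eval (n : ℤ)) hS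
    simp only [eval_sub, eval_comp, eval_add, eval_mul, eval_C, eval_X] at h5
    rw [h4]
    push_cast at h5 ⊢
    linarith
  have hlarge := (tendsto_mul_add_atTop hmD r).eventually_ge_atTop N
  obtain ⟨n₀, hn₀⟩ := hlarge.exists
  obtain ⟨e, he⟩ : (d j : ℤ) ∣ (P j).eval (r : ℤ) :=
    ⟨f (m * D * n₀ + r) - S.eval (n₀ : ℤ), by linear_combination -hval n₀ hn₀⟩
  refine ⟨C e + S, ?_⟩
  filter_upwards [hlarge] with n hn
  have := hval n hn
  rw [he, ← mul_add] at this
  simpa using mul_left_cancel₀ hd0 this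

/-- Two eventual quasi-polynomials agree with integer polynomials along common progressions. -/
theorem IsEQP.exists_common_eventuallyIntPolynomialMod {f g : ℕ → ℤ} (hf : IsEQP f)
    (hg : IsEQP g) :
    ∃ m, 0 < m ∧ EventuallyIntPolynomialMod f m ∧ EventuallyIntPolynomialMod g m := by
  obtain ⟨m, hm, hfm⟩ := hf.exists_eventuallyIntPolynomialMod
  obtain ⟨k, hk, hgk⟩ := hg.exists_eventuallyIntPolynomialMod
  exact ⟨m * k, Nat.mul_pos hm hk, hfm.mul_right hk, mul_comm k m ▸ hgk.mul_right hm⟩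

theorem IsEQP.congr {f g : ℕ → ℤ} (hf : IsEQP f) (h : ∀ᶠ n in atTop, f n = g n) : IsEQP g := by
  obtain ⟨N, m, c, hm, hc⟩ := hf
  obtain ⟨N', hN'⟩ := eventually_atTop.mp h
  exact ⟨max N N', m, c, hm, fun t ht => by
    rw [← hN' t (le_of_max_le_right ht), hc t (le_of_max_le_left ht)]⟩

theorem Polynomial.ne_zero_of_eventually_eval_pos {F : ℤ[X]}
    (hF : ∀ᶠ n : ℕ in atTop, 0 < F.eval (n : ℤ)) : F ≠ 0 := by
  rintro rfl
  simpa using hF.exists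

theorem Polynomial.isEQP_eval_emod_eval (U : ℤ[X]) {F : ℤ[X]}
    (hF : ∀ᶠ n : ℕ in atTop, 0 < F.eval (n : ℤ)) :
    IsEQP fun n => U.eval (n : ℤ) % F.eval (n : ℤ) := by
  set u := U.map (Int.castRingHom ℚ)
  set φ := F.map (Int.castRingHom ℚ)
  have hφ0 : φ ≠ 0 :=
    (Polynomial.map_ne_zero_iff Int.cast_injective).mpr (ne_zero_of_eventually_eval_pos hF)
  obtain ⟨D, hD, Q, hQ⟩ := exists_intPolynomial_map_eq_mul (u / φ)
  have hDq : (0 : ℚ) < D := by exact_mod_cast hD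
  have hsmall : ∀ᶠ n : ℕ in atTop, |(u % φ).eval (n : ℚ)| ≤ 1 / (2 * D) * |φ.eval (n : ℚ)| := by
    have h := (isLittleO_atTop_of_degree_lt (u % φ) φ (degree_mod_lt u hφ0)).def
      (c := 1 / (2 * D)) (by positivity)
    refine (tendsto_natCast_atTop_atTop.eventually h).mono fun n hn => ?_
    simp only [← Rat.norm_cast_real, Real.norm_eq_abs] at hn
    have hcast : ((|(u % φ).eval (n : ℚ)| : ℚ) : ℝ) ≤
        ((1 / (2 * D) * |φ.eval (n : ℚ)| : ℚ) : ℝ) := by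
      push_cast
      exact hn
    exact Rat.cast_le.mp hcast
  refine isEQP_of_forall_residue hD fun j _ => ?_
  set e := Q.eval (j : ℤ) % D
  have he0 : 0 ≤ e := Int.emod_nonneg _ (by positivity)
  have heD : e + 1 ≤ D := Int.emod_lt_of_pos _ (by positivity)
  set w := C ((e : ℚ) / D) * φ + u % φ with hw
  have hbound : ∀ᶠ n : ℕ in atTop, n % D = j →
      ∃ z : ℤ, w.eval (n : ℚ) = ((U.eval (n : ℤ) - F.eval (n : ℤ) * z : ℤ) : ℚ) ∧
        -F.eval (n : ℤ) ≤ U.eval (n : ℤ) - F.eval (n : ℤ) * z ∧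
        U.eval (n : ℤ) - F.eval (n : ℤ) * z < F.eval (n : ℤ) := by
    filter_upwards [hF, hsmall] with n hFn hn hnj
    have hmod : n % D = j % D := by rw [← hnj, Nat.mod_mod]
    have hdvd : (D : ℤ) ∣ Q.eval (n : ℤ) - e := by
      have h1 := Q.dvd_eval_sub_eval_of_mod_eq hmod
      have h2 : (D : ℤ) ∣ Q.eval (j : ℤ) - e := Int.dvd_self_sub_emod
      simpa using dvd_add h1 h2
    obtain ⟨z, hz⟩ := hdvd
    have hzq : (D : ℚ) * (u / φ).eval (n : ℚ) - e = D * z := by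
      have h := Q.cast_eval_natCast_eq n
      rw [hQ, eval_mul, eval_C] at h
      rw [← h]
      exact_mod_cast hz
    have hUn : ((U.eval (n : ℤ) : ℤ) : ℚ) = φ.eval (n : ℚ) * (u / φ).eval (n : ℚ)
        + (u % φ).eval (n : ℚ) := by
      rw [U.cast_eval_natCast_eq, ← eval_mul, ← eval_add, EuclideanDomain.div_add_mod]
    have hφn : φ.eval (n : ℚ) = ((F.eval (n : ℤ) : ℤ) : ℚ) := (F.cast_eval_natCast_eq n).symm
    have hFq : (0 : ℚ) < F.eval (n : ℤ) := by exact_mod_cast hFn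
    have hwn : w.eval (n : ℚ) = ((U.eval (n : ℤ) - F.eval (n : ℤ) * z : ℤ) : ℚ) := by
      have h1 : (u / φ).eval (n : ℚ) = e / D + z := by
        field_simp
        linarith
      push_cast
      rw [hUn, h1, hw, ← hφn, eval_add, eval_mul, eval_C]
      ring
    have hwe : w.eval (n : ℚ) = e / D * F.eval (n : ℤ) + (u % φ).eval (n : ℚ) := by
      rw [hw, eval_add, eval_mul, eval_C, hφn]
    rw [hφn, abs_of_pos hFq] at hn
    obtain ⟨hlo, hhi⟩ := abs_le.mp hn
    set x : ℚ := F.eval (n : ℤ) / D with hx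
    have hxpos : 0 < x := div_pos hFq hDq
    have hFx : ((F.eval (n : ℤ) : ℤ) : ℚ) = D * x := by rw [hx]; field_simp
    have hhalf : 1 / (2 * (D : ℚ)) * F.eval (n : ℤ) = x / 2 := by rw [hx]; field_simp
    have hex : (e : ℚ) / D * F.eval (n : ℤ) = e * x := by rw [hx]; field_simp
    rw [hhalf] at hlo hhi
    rw [hex] at hwe
    have he0q : (0 : ℚ) ≤ e := by exact_mod_cast he0
    have heDq : (e : ℚ) + 1 ≤ D := by exact_mod_cast heD
    refine ⟨z, hwn, ?_, ?_⟩
    · have : -((F.eval (n : ℤ) : ℤ) : ℚ) ≤ ((U.eval (n : ℤ) - F.eval (n : ℤ) * z : ℤ) : ℚ) := by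
        rw [← hwn, hwe, hFx]
        nlinarith
      exact_mod_cast this
    · have : ((U.eval (n : ℤ) - F.eval (n : ℤ) * z : ℤ) : ℚ) < ((F.eval (n : ℤ) : ℤ) : ℚ) := by
        rw [← hwn, hwe, hFx]
        nlinarith
      exact_mod_cast this
  rcases w.eventually_nonneg_or_eventually_neg with hsign | hsign
  · refine ⟨w, ?_⟩
    filter_upwards [hbound, tendsto_natCast_atTop_atTop.eventually hsign] with n hn hs hnj
    obtain ⟨z, hz, -, hlt⟩ := hn hnj
    rw [hz] at hs ⊢
    rw [← Int.emod_eq_of_lt (by exact_mod_cast hs) hlt, Int.sub_mul_emod_self_left]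
  · refine ⟨w + φ, ?_⟩
    filter_upwards [hbound, tendsto_natCast_atTop_atTop.eventually hsign] with n hn hs hnj
    obtain ⟨z, hz, hge, -⟩ := hn hnj
    rw [hz] at hs
    have hs' : U.eval (n : ℤ) - F.eval (n : ℤ) * z < 0 := by exact_mod_cast hs
    rw [eval_add, hz, ← F.cast_eval_natCast_eq, ← Int.cast_add,
      ← Int.emod_eq_of_lt (a := U.eval (n : ℤ) - F.eval (n : ℤ) * z + F.eval (n : ℤ))
        (b := F.eval (n : ℤ)) (by linarith) (by linarith),
      Int.add_emod_right, Int.sub_mul_emod_self_left]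

theorem IsEQP.emod {u f : ℕ → ℤ} (hu : IsEQP u) (hf : IsEQP f)
    (hpos : ∀ᶠ t in atTop, 0 < f t) : IsEQP fun t => u t % f t := by
  obtain ⟨m, hm, hum, hfm⟩ := hu.exists_common_eventuallyIntPolynomialMod hf
  refine isEQP_of_forall_isEQP_comp hm fun r _ => ?_
  obtain ⟨U, hU⟩ := hum r
  obtain ⟨F, hF⟩ := hfm r
  have hFpos : ∀ᶠ n : ℕ in atTop, 0 < F.eval (n : ℤ) := by
    filter_upwards [hF, (tendsto_mul_add_atTop hm r).eventually hpos] with n hn hp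
    rwa [← hn]
  refine (U.isEQP_eval_emod_eval hFpos).congr ?_
  filter_upwards [hU, hF] with n hUn hFn
  rw [hUn, hFn]

/-- Integer polynomials with coprime values at all large arguments are coprime over `ℚ`. -/
theorem Polynomial.isCoprime_map_of_eventually_isCoprime_eval {F G : ℤ[X]} (hF : F ≠ 0)
    (h : ∀ᶠ n : ℕ in atTop, IsCoprime (F.eval (n : ℤ)) (G.eval (n : ℤ))) :
    IsCoprime (F.map (Int.castRingHom ℚ)) (G.map (Int.castRingHom ℚ)) := by
  have hF0 : F.map (Int.castRingHom ℚ) ≠ 0 :=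
    (Polynomial.map_ne_zero_iff Int.cast_injective).mpr hF
  refine EuclideanDomain.isCoprime_of_dvd (fun h => hF0 h.1) ?_
  rintro q hq hq0 ⟨p₁, h₁⟩ ⟨p₂, h₂⟩
  have hdeg : 0 < q.degree := degree_pos_of_ne_zero_of_nonunit hq0 hq
  obtain ⟨d₁, hd₁, P₁, hP₁⟩ := exists_intPolynomial_map_eq_mul p₁
  obtain ⟨d₂, hd₂, P₂, hP₂⟩ := exists_intPolynomial_map_eq_mul p₂
  have hlarge : ∀ᶠ n : ℕ in atTop, ((d₁ * d₂ : ℕ) : ℚ) < |q.eval (n : ℚ)| :=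
    (((q.abs_tendsto_atTop hdeg).comp tendsto_natCast_atTop_atTop).eventually_gt_atTop _)
  obtain ⟨n, hn, x, y, hxy⟩ := (hlarge.and h).exists
  have hFn := F.cast_eval_natCast_eq n
  have hGn := G.cast_eval_natCast_eq n
  have hP₁n := P₁.cast_eval_natCast_eq n
  have hP₂n := P₂.cast_eval_natCast_eq n
  rw [h₁, eval_mul] at hFn
  rw [h₂, eval_mul] at hGn
  rw [hP₁, eval_mul, eval_C] at hP₁n
  rw [hP₂, eval_mul, eval_C] at hP₂n
  set k : ℤ := x * d₂ * P₁.eval (n : ℤ) + y * d₁ * P₂.eval (n : ℤ) with hk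
  have hmul : q.eval (n : ℚ) * k = ((d₁ * d₂ : ℕ) : ℚ) := by
    have hxy' : (x : ℚ) * F.eval (n : ℤ) + y * G.eval (n : ℤ) = 1 := by exact_mod_cast hxy
    rw [hFn, hGn] at hxy'
    rw [hk]
    push_cast
    rw [hP₁n, hP₂n]
    linear_combination (d₁ * d₂ : ℚ) * hxy'
  have hk0 : k ≠ 0 := by
    intro h0
    rw [h0, Int.cast_zero, mul_zero] at hmul
    have : ((d₁ * d₂ : ℕ) : ℚ) ≠ 0 := by exact_mod_cast (Nat.mul_pos hd₁ hd₂).ne'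
    exact this hmul.symm
  have hk1 : (1 : ℚ) ≤ |(k : ℚ)| := by exact_mod_cast Int.one_le_abs hk0
  have habs : |q.eval (n : ℚ)| * |(k : ℚ)| = ((d₁ * d₂ : ℕ) : ℚ) := by
    rw [← abs_mul, hmul, Nat.abs_cast]
  nlinarith [abs_nonneg (q.eval (n : ℚ))]

/-- Coprimality over `ℚ` gives an integral Bézout relation up to a positive constant. -/
theorem Polynomial.exists_bezout_of_isCoprime_map {F G : ℤ[X]}
    (h : IsCoprime (F.map (Int.castRingHom ℚ)) (G.map (Int.castRingHom ℚ))) :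
    ∃ D : ℕ, 0 < D ∧ ∃ P Q : ℤ[X], P * F + Q * G = C (D : ℤ) := by
  obtain ⟨p, q, hpq⟩ := h
  obtain ⟨d, hd, P, hP⟩ := exists_intPolynomial_map_eq_mul p
  obtain ⟨e, he, Q, hQ⟩ := exists_intPolynomial_map_eq_mul q
  refine ⟨d * e, Nat.mul_pos hd he, C (e : ℤ) * P, C (d : ℤ) * Q, ?_⟩
  apply map_injective (Int.castRingHom ℚ) Int.cast_injective
  simp only [Polynomial.map_add, Polynomial.map_mul, hP, hQ, map_C]
  push_cast
  simp only [map_mul, map_natCast]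
  linear_combination (d * e : ℚ[X]) * hpq

theorem Polynomial.exists_isEQP_inverse {F G : ℤ[X]} (hF : F ≠ 0)
    (h : ∀ᶠ n : ℕ in atTop, IsCoprime (F.eval (n : ℤ)) (G.eval (n : ℤ))) :
    ∃ y : ℕ → ℤ, IsEQP y ∧ ∀ n : ℕ, F.eval (n : ℤ) ∣ G.eval (n : ℤ) * y n - 1 := by
  obtain ⟨D, hD, P, Q, hPQ⟩ :=
    exists_bezout_of_isCoprime_map (isCoprime_map_of_eventually_isCoprime_eval hF h)
  have hbase : ∀ j : ℕ, ∃ a b : ℤ, ∀ n : ℕ, n % D = j % D →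
      (D : ℤ) ∣ 1 - (a * F.eval (n : ℤ) + b * G.eval (n : ℤ)) := by
    intro j
    obtain ⟨k, a, b, hab⟩ := ((tendsto_mul_add_atTop hD j).eventually h).exists
    refine ⟨a, b, fun n hn => ?_⟩
    have hmod : (D * k + j) % D = n % D := by rw [Nat.mul_add_mod, hn]
    obtain ⟨u, hu⟩ := F.dvd_eval_sub_eval_of_mod_eq hmod
    obtain ⟨v, hv⟩ := G.dvd_eval_sub_eval_of_mod_eq hmod
    exact ⟨a * u + b * v, by linear_combination a * hu + b * hv - hab⟩
  choose a b hab using hbase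
  choose k hk using fun n : ℕ => hab (n % D) n (Nat.mod_mod n D).symm
  refine ⟨fun n => b (n % D) + k n * Q.eval (n : ℤ), ?_, fun n => ?_⟩
  · refine ⟨0, D, fun j => C (b j : ℚ) + C (D : ℚ)⁻¹ *
      (1 - (C (a j : ℚ) * F.map (Int.castRingHom ℚ) + C (b j : ℚ) * G.map (Int.castRingHom ℚ))) *
        Q.map (Int.castRingHom ℚ), hD, fun n _ => ?_⟩
    have hDq : (D : ℚ) ≠ 0 := by exact_mod_cast hD.ne'
    have hkq : 1 - ((a (n % D) : ℚ) * F.eval (n : ℤ) + b (n % D) * G.eval (n : ℤ)) = D * k n := by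
      exact_mod_cast hk n
    simp only [eval_add, eval_mul, eval_sub, eval_one, eval_C, ← cast_eval_natCast_eq]
    rw [hkq]
    push_cast
    field_simp
  · have hn := congrArg (eval (n : ℤ)) hPQ
    simp only [eval_add, eval_mul, eval_C] at hn
    exact ⟨-(a (n % D) + k n * P.eval (n : ℤ)), by linear_combination k n * hn - hk n⟩

theorem IsEQP.exists_isEQP_inverse {f g : ℕ → ℤ} (hf : IsEQP f) (hg : IsEQP g)
    (hpos : ∀ᶠ t in atTop, 0 < f t) (hco : ∀ᶠ t in atTop, IsCoprime (f t) (g t)) :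
    ∃ y : ℕ → ℤ, IsEQP y ∧ ∀ᶠ t in atTop, f t ∣ g t * y t - 1 := by
  obtain ⟨m, hm, hfm, hgm⟩ := hf.exists_common_eventuallyIntPolynomialMod hg
  have hclass : ∀ r : ℕ, ∃ y : ℕ → ℤ, IsEQP y ∧
      ∀ᶠ n in atTop, f (m * n + r) ∣ g (m * n + r) * y n - 1 := by
    intro r
    obtain ⟨F, hF⟩ := hfm r
    obtain ⟨G, hG⟩ := hgm r
    have hF0 : F ≠ 0 := by
      apply ne_zero_of_eventually_eval_pos
      filter_upwards [hF, (tendsto_mul_add_atTop hm r).eventually hpos] with n hn hp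
      rwa [← hn]
    have hFG : ∀ᶠ n : ℕ in atTop, IsCoprime (F.eval (n : ℤ)) (G.eval (n : ℤ)) := by
      filter_upwards [hF, hG, (tendsto_mul_add_atTop hm r).eventually hco] with n hFn hGn hn
      rwa [← hFn, ← hGn]
    obtain ⟨y, hy, hdvd⟩ := Polynomial.exists_isEQP_inverse hF0 hFG
    refine ⟨y, hy, ?_⟩
    filter_upwards [hF, hG] with n hFn hGn
    rw [hFn, hGn]
    exact hdvd n
  choose y hy hdvd using hclass
  refine ⟨fun t => y (t % m) (t / m), isEQP_of_forall_isEQP_comp hm fun r hr => ?_, ?_⟩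
  · simpa [Nat.mul_add_mod, Nat.mod_eq_of_lt hr, Nat.mul_add_div hm, Nat.div_eq_of_lt hr]
      using hy r
  · have hall : ∀ᶠ n in atTop, ∀ r ∈ Finset.range m, f (m * n + r) ∣ g (m * n + r) * y r n - 1 :=
      (Filter.eventually_all_finset _).mpr fun r _ => hdvd r
    filter_upwards [(Nat.tendsto_div_const_atTop hm.ne').eventually hall] with t ht
    simpa only [Nat.div_add_mod] using ht (t % m) (Finset.mem_range.mpr (Nat.mod_lt t hm))

/-- **Rødseth step 3, parametric.** For eventual quasi-polynomials `f, g, a` with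
`f, g` eventually positive and `gcd(f(t), g(t)) = 1` eventually, there is an
eventual quasi-polynomial `s₀` with, eventually,
`g(t) s₀(t) ≡ a(t) (mod f(t))` and `0 ≤ s₀(t) < f(t)`. -/
theorem eqp_congruence_solution (f g a : ℕ → ℤ) (hf : IsEQP f) (hg : IsEQP g)
    (ha : IsEQP a) (hfp : EventuallyPos f) (hgp : EventuallyPos g)
    (hco : ∃ N, ∀ t : ℕ, N ≤ t → Int.gcd (f t) (g t) = 1) :
    ∃ s₀ : ℕ → ℤ, IsEQP s₀ ∧
      ∃ N, ∀ t : ℕ, N ≤ t →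
        f t ∣ (g t * s₀ t - a t) ∧ 0 ≤ s₀ t ∧ s₀ t < f t := by
  obtain ⟨y, hy, hinv⟩ := hf.exists_isEQP_inverse hg (eventually_atTop.mpr hfp)
    ((eventually_atTop.mpr hco).mono fun t ht => Int.isCoprime_iff_gcd_eq_one.mpr ht)
  refine ⟨fun t => a t * y t % f t, (ha.mul hy).emod hf (eventually_atTop.mpr hfp),
    eventually_atTop.mp ?_⟩
  filter_upwards [hinv, eventually_atTop.mpr hfp] with t ht hpos
  refine ⟨?_, Int.emod_nonneg _ hpos.ne', Int.emod_lt_of_pos _ hpos⟩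
  obtain ⟨k, hk⟩ := ht
  obtain ⟨l, hl⟩ : f t ∣ a t * y t - a t * y t % f t := Int.dvd_self_sub_emod
  exact ⟨a t * k - g t * l, by linear_combination a t * hk - g t * hl⟩
end
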